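/- Theorem (hydrodynamic limit of quantum random walks): fix a continuous γ : ℝ → ℝ≥0 with compact support and t > 0. For each n ≥ 1, let η_{⌊tn⌋} be the observed particle field at time ⌊tn⌋ of the system of independent Hadamard quantum random walks with initial configuration distributed according to Θ_γ^n; equivalently (by the product-Poisson identity), let η_{⌊tn⌋} = (η_{⌊tn⌋}(j))_{j∈ℤ} be distributed according to ⊗_{j∈ℤ} Poisson(B(j, ⌊tn⌋)) with B(j, m) := Σ_{k∈ℤ} γ(k/n) p_m(k, j). Then for every continuous H : ℝ → ℝ with compact support, the random variables (1/n) Σ_{k∈ℤ} H(k/n) η_{⌊tn⌋}(k) converge in probability, as n → ∞, to ∫_ℝ H(x) ρ(t, x) dx, where ρ(t, x) = (γ * f_t)(x) = ∫_ℝ γ(y)(1/t) f((x−y)/t) dy. -/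

import Mathlib

open MeasureTheory ProbabilityTheory Filter
open scoped NNReal ENNReal Topology

noncomputable section

/-- The state space `ℓ²(ℤ; ℂ²)` of the Hadamard quantum walk. -/
abbrev QWState : Type := lp (fun _ : ℤ => EuclideanSpace ℂ (Fin 2)) 2

/-- The walk started at site `k` with pure coin state `c`
(`c = 0` is the coin `+`, `c = 1` is the coin `−`): the unit vector `δ_k ⊗ c`. -/
def deltaCoin (k : ℤ) (c : Fin 2) : QWState := lp.single 2 k (EuclideanSpace.single c 1)

/-- The Konno density: `f(x) = 1/(π(1−x²)√(1−2x²))` for `|x| < 1/√2`, and `0` otherwise. -/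
def konno (x : ℝ) : ℝ :=
  if |x| < 1 / Real.sqrt 2 then 1 / (Real.pi * (1 - x ^ 2) * Real.sqrt (1 - 2 * x ^ 2)) else 0


/-! ### A weak law for independent Poisson variables -/

lemma hasSum_poisson_mul_id (r : ℝ≥0) :
    HasSum (fun n : ℕ => Real.exp (-r) * r ^ n / (n.factorial : ℝ) * (n : ℝ)) r := by
  rw [← hasSum_nat_add_iff' 1]
  have h := (hasSum_one_poissonMeasure r).mul_left (r : ℝ)
  simp only [mul_one] at h
  convert! h using 1
  · ext n
    rw [Nat.factorial_succ]
    push_cast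
    field_simp
    ring
  · simp

lemma hasSum_poisson_mul_sq (r : ℝ≥0) :
    HasSum (fun n : ℕ => Real.exp (-r) * r ^ n / (n.factorial : ℝ) * (n : ℝ) ^ 2)
      ((r : ℝ) * (r + 1)) := by
  rw [← hasSum_nat_add_iff' 1]
  have h := ((hasSum_poisson_mul_id r).add (hasSum_one_poissonMeasure r)).mul_left (r : ℝ)
  convert! h using 1
  · ext n
    rw [Nat.factorial_succ]
    push_cast
    field_simp
    ring
  · simp

lemma integral_natCast_poissonMeasure (r : ℝ≥0) :
    ∫ n : ℕ, (n : ℝ) ∂(poissonMeasure r) = r := by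
  rw [integral_poissonMeasure]
  exact (hasSum_poisson_mul_id r).tsum_eq

lemma memLp_natCast_poissonMeasure (r : ℝ≥0) :
    MemLp (fun n : ℕ => (n : ℝ)) 2 (poissonMeasure r) := by
  rw [memLp_two_iff_integrable_sq (by fun_prop), integrable_poissonMeasure_iff]
  simpa using (hasSum_poisson_mul_sq r).summable

lemma variance_natCast_poissonMeasure (r : ℝ≥0) :
    Var[fun n : ℕ => (n : ℝ); poissonMeasure r] = r := by
  rw [variance_eq_sub (memLp_natCast_poissonMeasure r), integral_natCast_poissonMeasure]
  have : ∫ n : ℕ, ((fun n : ℕ => (n : ℝ)) ^ 2) n ∂(poissonMeasure r) = r * (r + 1) := by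
    rw [integral_poissonMeasure]
    exact (hasSum_poisson_mul_sq r).tsum_eq
  rw [this]
  ring

/-- Chebyshev's inequality for a weighted sum of independent Poisson variables. -/
lemma measure_pi_poisson_le {ι : Type*} [Fintype ι] (r : ι → ℝ≥0) (h : ι → ℝ) {ε : ℝ}
    (hε : 0 < ε) :
    Measure.pi (fun i => poissonMeasure (r i))
        {η : ι → ℕ | ε ≤ |∑ i, h i * (η i : ℝ) - ∑ i, h i * (r i : ℝ)|}
      ≤ ENNReal.ofReal ((∑ i, h i ^ 2 * (r i : ℝ)) / ε ^ 2) := by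
  have hL : ∀ i, MemLp (fun n : ℕ => h i * (n : ℝ)) 2 (poissonMeasure (r i)) := fun i =>
    (memLp_natCast_poissonMeasure (r i)).const_mul (h i)
  have hL' : ∀ i, MemLp (fun η : ι → ℕ => h i * (η i : ℝ)) 2
      (Measure.pi fun i => poissonMeasure (r i)) := fun i =>
    (hL i).comp_measurePreserving (measurePreserving_eval _ i)
  have hsum : (∑ i, fun η : ι → ℕ => h i * (η i : ℝ)) = fun η => ∑ i, h i * (η i : ℝ) := by
    ext η
    simp
  have hvar : Var[fun η : ι → ℕ => ∑ i, h i * (η i : ℝ);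
      Measure.pi fun i => poissonMeasure (r i)] = ∑ i, h i ^ 2 * (r i : ℝ) := by
    rw [← hsum, variance_sum_pi (X := fun i (n : ℕ) => h i * (n : ℝ)) hL]
    refine Finset.sum_congr rfl fun i _ => ?_
    rw [variance_const_mul, variance_natCast_poissonMeasure]
  have hmean : ∫ η : ι → ℕ, ∑ i, h i * (η i : ℝ) ∂(Measure.pi fun i => poissonMeasure (r i))
      = ∑ i, h i * (r i : ℝ) := by
    rw [integral_finsetSum _ fun i _ => (hL' i).integrable (by norm_num)]
    refine Finset.sum_congr rfl fun i _ => ?_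
    rw [integral_const_mul]
    congr 1
    rw [integral_comp_eval (μ := fun i => poissonMeasure (r i)) (f := fun n : ℕ => (n : ℝ))
      (by fun_prop), integral_natCast_poissonMeasure]
  have hmem : MemLp (fun η : ι → ℕ => ∑ i, h i * (η i : ℝ)) 2
      (Measure.pi fun i => poissonMeasure (r i)) := memLp_finsetSum _ fun i _ => hL' i
  have := meas_ge_le_variance_div_sq hmem hε
  rwa [hmean, hvar] at this

/-! ### The Konno density as the law of the group velocity -/

/-- The group velocity of the Hadamard walk at momentum `θ`. -/
def groupVelocity (θ : ℝ) : ℝ := Real.cos θ / Real.sqrt (1 + Real.cos θ ^ 2)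

lemma continuous_groupVelocity : Continuous groupVelocity := by
  unfold groupVelocity
  refine Real.continuous_cos.div (by fun_prop) fun θ => ?_
  positivity

lemma hasDerivAt_groupVelocity (θ : ℝ) :
    HasDerivAt groupVelocity
      (-Real.sin θ / ((1 + Real.cos θ ^ 2) * Real.sqrt (1 + Real.cos θ ^ 2))) θ := by
  have hpos : 0 < 1 + Real.cos θ ^ 2 := by positivity
  have h1 : HasDerivAt (fun θ => 1 + Real.cos θ ^ 2) (2 * Real.cos θ * (-Real.sin θ)) θ := by
    simpa using ((Real.hasDerivAt_cos θ).pow 2).const_add 1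
  have h2 := (Real.hasDerivAt_cos θ).div (h1.sqrt hpos.ne') (by positivity)
  convert! h2 using 1
  have hs : Real.sqrt (1 + Real.cos θ ^ 2) ^ 2 = 1 + Real.cos θ ^ 2 := Real.sq_sqrt hpos.le
  have hs0 : Real.sqrt (1 + Real.cos θ ^ 2) ≠ 0 := by positivity
  set s := Real.sqrt (1 + Real.cos θ ^ 2)
  rw [← hs]
  field_simp
  rw [hs]
  ring

lemma groupVelocity_sq (θ : ℝ) :
    groupVelocity θ ^ 2 = Real.cos θ ^ 2 / (1 + Real.cos θ ^ 2) := by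
  rw [groupVelocity, div_pow, Real.sq_sqrt (by positivity)]

lemma injOn_groupVelocity : Set.InjOn groupVelocity (Set.Ioo 0 Real.pi) := by
  have hneg : ∀ θ ∈ interior (Set.Icc 0 Real.pi), deriv groupVelocity θ < 0 := by
    intro θ hθ
    rw [interior_Icc] at hθ
    rw [(hasDerivAt_groupVelocity θ).deriv]
    have := Real.sin_pos_of_mem_Ioo hθ
    apply div_neg_of_neg_of_pos (by linarith)
    positivity
  exact ((strictAntiOn_of_deriv_neg (convex_Icc 0 Real.pi)
    continuous_groupVelocity.continuousOn hneg).injOn).mono Set.Ioo_subset_Icc_self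

lemma abs_lt_one_div_sqrt_two_iff (x : ℝ) : |x| < 1 / Real.sqrt 2 ↔ 2 * x ^ 2 < 1 := by
  have h : (1 / Real.sqrt 2) ^ 2 = 1 / 2 := by
    rw [div_pow, Real.sq_sqrt (by norm_num)]
    norm_num
  rw [← sq_lt_sq₀ (abs_nonneg x) (by positivity), sq_abs, h]
  constructor <;> intro h <;> linarith

lemma image_groupVelocity :
    groupVelocity '' Set.Ioo 0 Real.pi = {x | |x| < 1 / Real.sqrt 2} := by
  ext x
  simp only [Set.mem_image, Set.mem_ofPred_eq, abs_lt_one_div_sqrt_two_iff]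
  constructor
  · rintro ⟨θ, hθ, rfl⟩
    have hs := Real.sin_pos_of_mem_Ioo hθ
    have hcs := Real.sin_sq_add_cos_sq θ
    rw [groupVelocity_sq, ← mul_div_assoc, div_lt_one (by positivity)]
    nlinarith
  · intro hx
    have h1 : 0 < 1 - x ^ 2 := by nlinarith
    set c := x / Real.sqrt (1 - x ^ 2) with hc
    have hc2 : c ^ 2 = x ^ 2 / (1 - x ^ 2) := by
      rw [hc, div_pow, Real.sq_sqrt h1.le]
    have hc1 : c ^ 2 < 1 ^ 2 := by
      rw [hc2, one_pow, div_lt_one h1]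
      linarith
    have habs := abs_lt.1 (by simpa using sq_lt_sq.1 hc1 : |c| < 1)
    refine ⟨Real.arccos c, ⟨Real.arccos_pos.2 habs.2, ?_⟩, ?_⟩
    · refine lt_of_le_of_ne (Real.arccos_le_pi c) fun h => ?_
      exact absurd (Real.arccos_eq_pi.1 h) (not_le.2 habs.1)
    · rw [groupVelocity, Real.cos_arccos habs.1.le habs.2.le]
      have : 1 + c ^ 2 = (1 - x ^ 2)⁻¹ := by
        rw [hc2]
        field_simp
        ring
      rw [this, Real.sqrt_inv, hc]
      have : Real.sqrt (1 - x ^ 2) ≠ 0 := (Real.sqrt_pos.2 h1).ne'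
      field_simp

lemma abs_deriv_mul_konno_groupVelocity {θ : ℝ} (hθ : θ ∈ Set.Ioo 0 Real.pi) :
    |-Real.sin θ / ((1 + Real.cos θ ^ 2) * Real.sqrt (1 + Real.cos θ ^ 2))|
      * konno (groupVelocity θ) = 1 / Real.pi := by
  have hmem : |groupVelocity θ| < 1 / Real.sqrt 2 := by
    have : groupVelocity θ ∈ groupVelocity '' Set.Ioo 0 Real.pi := ⟨θ, hθ, rfl⟩
    rwa [image_groupVelocity] at this
  have hs := Real.sin_pos_of_mem_Ioo hθ
  have hcs := Real.sin_sq_add_cos_sq θ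
  have hpos : 0 < 1 + Real.cos θ ^ 2 := by positivity
  have h2 : 1 - 2 * groupVelocity θ ^ 2 = Real.sin θ ^ 2 / (1 + Real.cos θ ^ 2) := by
    rw [groupVelocity_sq]
    field_simp
    linarith
  have h1 : 1 - groupVelocity θ ^ 2 = 1 / (1 + Real.cos θ ^ 2) := by
    rw [groupVelocity_sq]
    field_simp
    ring
  rw [konno, if_pos hmem, h1, h2, Real.sqrt_div (by positivity), Real.sqrt_sq hs.le, abs_div,
    abs_neg, abs_of_pos hs, abs_of_pos (by positivity)]
  field_simp

/-- If `θ` is uniform on `(0, π)` then `groupVelocity θ` has density `konno`. -/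
lemma integral_mul_konno (g : ℝ → ℝ) :
    ∫ x, g x * konno x = 1 / Real.pi * ∫ θ in Set.Ioo 0 Real.pi, g (groupVelocity θ) := by
  have hsupp : ∫ x, g x * konno x = ∫ x in {x | |x| < 1 / Real.sqrt 2}, g x * konno x := by
    refine (setIntegral_eq_integral_of_forall_compl_eq_zero fun x hx => ?_).symm
    simp only [Set.mem_ofPred_eq] at hx
    rw [konno, if_neg hx, mul_zero]
  rw [hsupp, ← image_groupVelocity, integral_image_eq_integral_abs_deriv_smul measurableSet_Ioo
    (fun θ _ => (hasDerivAt_groupVelocity θ).hasDerivWithinAt) injOn_groupVelocity,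
    ← integral_const_mul]
  refine setIntegral_congr_fun measurableSet_Ioo fun θ hθ => ?_
  simp only [smul_eq_mul]
  rw [← abs_deriv_mul_konno_groupVelocity hθ]
  ring

lemma integrable_konno : Integrable konno := by
  have h : IntegrableOn konno {x | |x| < 1 / Real.sqrt 2} := by
    rw [← image_groupVelocity, integrableOn_image_iff_integrableOn_abs_deriv_smul measurableSet_Ioo
      (fun θ _ => (hasDerivAt_groupVelocity θ).hasDerivWithinAt) injOn_groupVelocity]
    refine (integrableOn_const (C := 1 / Real.pi) (by simp)).congr_fun
      (fun θ hθ => ?_) measurableSet_Ioo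
    exact (abs_deriv_mul_konno_groupVelocity hθ).symm
  rwa [integrableOn_iff_integrable_of_support_subset fun x hx => ?_] at h
  by_contra hx'
  simp only [Set.mem_ofPred_eq] at hx'
  exact hx (by rw [konno, if_neg hx'])

/-- The macroscopic limit in terms of the group velocity. -/
lemma integral_mul_integral_konno {γ H : ℝ → ℝ} (hγ : Continuous γ) (hγs : HasCompactSupport γ)
    (hH : Continuous H) (hHs : HasCompactSupport H) {t : ℝ} (ht : 0 < t) :
    ∫ x, H x * ∫ y, γ y * ((1 / t) * konno ((x - y) / t))
      = ∫ y, γ y * (1 / Real.pi * ∫ θ in Set.Ioo 0 Real.pi, H (y + t * groupVelocity θ)) := by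
  have hk : Integrable fun x => (1 / t) * konno (x / t) :=
    (integrable_konno.comp_div ht.ne').const_mul _
  have hγi : Integrable γ := hγ.integrable_of_hasCompactSupport hγs
  obtain ⟨C, hC⟩ := hHs.exists_bound_of_continuous hH
  have hint : Integrable (fun q : ℝ × ℝ => H q.1 * (γ q.2 * ((1 / t) * konno ((q.1 - q.2) / t))))
      (volume.prod volume) := by
    refine Integrable.bdd_mul (c := C) ?_ (hH.comp continuous_fst).aestronglyMeasurable
      (Filter.Eventually.of_forall fun q => hC q.1)
    simpa using hγi.convolution_integrand (ContinuousLinearMap.mul ℝ ℝ) hk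
  simp_rw [← integral_const_mul (H _)]
  rw [integral_integral_swap hint]
  refine integral_congr_ae (Filter.Eventually.of_forall fun y => ?_)
  simp only
  rw [← integral_mul_konno (fun v => H (y + t * v)), ← integral_const_mul]
  have h1 := integral_sub_right_eq_self
    (fun z => γ y * (H (y + z) * ((1 / t) * konno (z / t)))) y (μ := volume)
  have h2 := Measure.integral_comp_mul_left
    (fun z => γ y * (H (y + z) * ((1 / t) * konno (z / t)))) t
  calc ∫ x, H x * (γ y * ((1 / t) * konno ((x - y) / t)))
      = ∫ x, γ y * (H (y + (x - y)) * ((1 / t) * konno ((x - y) / t))) := by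
        refine integral_congr_ae (Filter.Eventually.of_forall fun x => ?_)
        simp only [add_sub_cancel]
        ring
    _ = ∫ z, γ y * (H (y + z) * ((1 / t) * konno (z / t))) := h1
    _ = t * ∫ v, γ y * (H (y + t * v) * ((1 / t) * konno (t * v / t))) := by
        rw [h2, abs_of_pos (inv_pos.2 ht), smul_eq_mul, ← mul_assoc, mul_inv_cancel₀ ht.ne',
          one_mul]
    _ = ∫ v, γ y * (H (y + t * v) * konno v) := by
        rw [← integral_const_mul]
        refine integral_congr_ae (Filter.Eventually.of_forall fun v => ?_)
        simp only [mul_div_cancel_left₀ v ht.ne']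
        field_simp

/-! ### Fourier analysis of the walk -/

lemma deltaCoin_apply (k j : ℤ) (c b : Fin 2) :
    deltaCoin k c j b = if j = k ∧ b = c then 1 else 0 := by
  by_cases h : j = k
  · subst h
    simp [deltaCoin]
  · simp [deltaCoin, h]

lemma Int.notMem_Icc_neg_iff (m : ℕ) (j : ℤ) : j ∉ Finset.Icc (-(m : ℤ)) m ↔ (m : ℤ) < |j| := by
  rw [Finset.mem_Icc, ← abs_le, not_le]

/-- The defining equations of the Hadamard quantum walk operator. -/
def IsHadamardWalk (U : QWState →ₗ[ℂ] QWState) : Prop :=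
  ∀ (ψ : QWState) (k : ℤ),
    (U ψ) k 0 = (ψ (k - 1) 0 + ψ (k - 1) 1) / (Real.sqrt 2 : ℂ) ∧
    (U ψ) k 1 = (ψ (k + 1) 0 - ψ (k + 1) 1) / (Real.sqrt 2 : ℂ)

namespace IsHadamardWalk

variable {U : QWState →ₗ[ℂ] QWState}

lemma pow_deltaCoin_translate (hU : IsHadamardWalk U) (m : ℕ) (k : ℤ) (c : Fin 2) (j : ℤ) :
    (U ^ m) (deltaCoin k c) j = (U ^ m) (deltaCoin 0 c) (j - k) := by
  induction m generalizing j with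
  | zero =>
    ext b
    simp [deltaCoin_apply, sub_eq_zero]
  | succ m ih =>
    rw [pow_succ', Module.End.mul_apply, Module.End.mul_apply]
    ext b
    fin_cases b
    · simp only [Fin.zero_eta, (hU _ _).1, ih, sub_right_comm]
    · simp only [Fin.mk_one, (hU _ _).2, ih, sub_add_eq_add_sub]

lemma pow_deltaCoin_eq_zero (hU : IsHadamardWalk U) (m : ℕ) (c : Fin 2) (j : ℤ)
    (hj : (m : ℤ) < |j|) : (U ^ m) (deltaCoin 0 c) j = 0 := by
  induction m generalizing j with
  | zero =>
    ext b
    have : j ≠ 0 := by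
      rintro rfl
      simp at hj
    simp [deltaCoin_apply, this]
  | succ m ih =>
    have h1 : (m : ℤ) < |j - 1| := by
      push_cast at hj
      grind
    have h2 : (m : ℤ) < |j + 1| := by
      push_cast at hj
      grind
    rw [pow_succ', Module.End.mul_apply]
    ext b
    fin_cases b
    · simp [(hU _ _).1, ih _ h1]
    · simp [(hU _ _).2, ih _ h2]

end IsHadamardWalk

/-- The Fourier symbol of the Hadamard walk operator. -/
def walkSymbol (θ : ℝ) : Matrix (Fin 2) (Fin 2) ℂ :=
  !![Complex.exp (θ * Complex.I) / (Real.sqrt 2 : ℂ), Complex.exp (θ * Complex.I) / (Real.sqrt 2 : ℂ);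
    Complex.exp (-θ * Complex.I) / (Real.sqrt 2 : ℂ),
    -Complex.exp (-θ * Complex.I) / (Real.sqrt 2 : ℂ)]

lemma IsHadamardWalk.tsum_pow_deltaCoin {U : QWState →ₗ[ℂ] QWState} (hU : IsHadamardWalk U)
    (m : ℕ) (c b : Fin 2) (θ : ℝ) :
    ∑' j : ℤ, (U ^ m) (deltaCoin 0 c) j b * Complex.exp (j * θ * Complex.I)
      = (walkSymbol θ ^ m) b c := by
  induction m generalizing b with
  | zero =>
    rw [tsum_eq_single 0]
    · simp [deltaCoin_apply, Matrix.one_apply]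
    · intro j hj
      simp [deltaCoin_apply, hj]
  | succ m ih =>
    have hs : ∀ a, Summable fun j : ℤ =>
        (U ^ m) (deltaCoin 0 c) j a * Complex.exp (j * θ * Complex.I) := fun a =>
      summable_of_ne_finset_zero (s := Finset.Icc (-(m : ℤ)) m) fun j hj => by
        rw [hU.pow_deltaCoin_eq_zero m c j ((Int.notMem_Icc_neg_iff m j).1 hj)]
        simp
    rw [pow_succ' U, Module.End.mul_apply, pow_succ' (walkSymbol θ), Matrix.mul_apply,
      Fin.sum_univ_two, ← ih, ← ih]
    set ψ := (U ^ m) (deltaCoin 0 c)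
    fin_cases b
    · simp only [Fin.zero_eta, (hU _ _).1]
      rw [← (Equiv.subRight (1 : ℤ)).tsum_eq fun j : ℤ => ψ j 0 * Complex.exp (j * θ * Complex.I),
        ← (Equiv.subRight (1 : ℤ)).tsum_eq fun j : ℤ => ψ j 1 * Complex.exp (j * θ * Complex.I),
        ← tsum_mul_left, ← tsum_mul_left, ← Summable.tsum_add]
      · refine tsum_congr fun j => ?_
        have : Complex.exp (j * θ * Complex.I)
            = Complex.exp (θ * Complex.I) * Complex.exp (((j - 1 : ℤ) : ℂ) * θ * Complex.I) := by
          rw [← Complex.exp_add]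
          push_cast
          ring_nf
        simp only [Equiv.subRight_apply, walkSymbol, Matrix.of_apply, Matrix.cons_val', this,
          Matrix.cons_val_zero, Matrix.cons_val_one, Matrix.cons_val_fin_one]
        ring
      · exact ((Equiv.subRight (1 : ℤ)).summable_iff.2 (hs 0)).mul_left _
      · exact ((Equiv.subRight (1 : ℤ)).summable_iff.2 (hs 1)).mul_left _
    · simp only [Fin.mk_one, (hU _ _).2]
      rw [← (Equiv.addRight (1 : ℤ)).tsum_eq fun j : ℤ => ψ j 0 * Complex.exp (j * θ * Complex.I),
        ← (Equiv.addRight (1 : ℤ)).tsum_eq fun j : ℤ => ψ j 1 * Complex.exp (j * θ * Complex.I),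
        ← tsum_mul_left, ← tsum_mul_left, ← Summable.tsum_add]
      · refine tsum_congr fun j => ?_
        have : Complex.exp (j * θ * Complex.I)
            = Complex.exp (-θ * Complex.I) * Complex.exp (((j + 1 : ℤ) : ℂ) * θ * Complex.I) := by
          rw [← Complex.exp_add]
          push_cast
          ring_nf
        simp only [Equiv.coe_addRight, walkSymbol, Matrix.of_apply, Matrix.cons_val', this,
          Matrix.cons_val_zero, Matrix.cons_val_one, Matrix.cons_val_fin_one]
        ring
      · exact ((Equiv.addRight (1 : ℤ)).summable_iff.2 (hs 0)).mul_left _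
      · exact ((Equiv.addRight (1 : ℤ)).summable_iff.2 (hs 1)).mul_left _

lemma integral_exp_int_mul (n : ℤ) :
    ∫ θ in (-Real.pi)..Real.pi, Complex.exp (n * θ * Complex.I)
      = if n = 0 then 2 * (Real.pi : ℂ) else 0 := by
  split_ifs with h
  · simp [h]
    ring
  · have hc : (n : ℂ) * Complex.I ≠ 0 := mul_ne_zero (by exact_mod_cast h) Complex.I_ne_zero
    have := integral_exp_mul_complex (a := -Real.pi) (b := Real.pi) hc
    simp_rw [mul_right_comm _ Complex.I] at this
    rw [this, div_eq_zero_iff]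
    left
    rw [sub_eq_zero, Complex.exp_eq_exp_iff_exists_int]
    refine ⟨n, ?_⟩
    push_cast
    ring

/-- Parseval's identity with a shift, for trigonometric polynomials. -/
lemma sum_norm_sq_mul_exp (S : Finset ℤ) (φ : ℤ → ℂ) (ξ : ℝ) :
    ∑ j ∈ S, (‖φ j‖ : ℂ) ^ 2 * Complex.exp (j * ξ * Complex.I)
      = 1 / (2 * Real.pi) * ∫ θ in (-Real.pi)..Real.pi,
        star (∑ j ∈ S, φ j * Complex.exp (j * θ * Complex.I)) *
          ∑ j ∈ S, φ j * Complex.exp (j * (θ + ξ : ℝ) * Complex.I) := by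
  have hexp : ∀ θ : ℝ, star (∑ j ∈ S, φ j * Complex.exp (j * θ * Complex.I)) *
      ∑ j ∈ S, φ j * Complex.exp (j * (θ + ξ : ℝ) * Complex.I)
      = ∑ j ∈ S, ∑ k ∈ S, (star (φ j) * φ k * Complex.exp (k * ξ * Complex.I))
        * Complex.exp ((k - j : ℤ) * θ * Complex.I) := by
    intro θ
    rw [star_sum, Finset.sum_mul_sum]
    refine Finset.sum_congr rfl fun j _ => Finset.sum_congr rfl fun k _ => ?_
    have h1 : star (Complex.exp (j * θ * Complex.I)) = Complex.exp (-(j * θ * Complex.I)) := by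
      rw [Complex.star_def, ← Complex.exp_conj]
      simp
    have h2 : Complex.exp ((k - j : ℤ) * θ * Complex.I)
        = Complex.exp (-(j * θ * Complex.I)) * Complex.exp (k * θ * Complex.I) := by
      rw [← Complex.exp_add]
      push_cast
      ring_nf
    have h3 : Complex.exp (k * (θ + ξ : ℝ) * Complex.I)
        = Complex.exp (k * θ * Complex.I) * Complex.exp (k * ξ * Complex.I) := by
      rw [← Complex.exp_add]
      push_cast
      ring_nf
    rw [star_mul', h1, h2, h3]
    ring
  simp_rw [hexp]
  rw [intervalIntegral.integral_finsetSum fun j _ => Continuous.intervalIntegrable (by fun_prop) _ _,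
    Finset.mul_sum]
  refine Finset.sum_congr rfl fun j hj => ?_
  rw [intervalIntegral.integral_finsetSum fun j _ => Continuous.intervalIntegrable (by fun_prop) _ _,
    Finset.sum_eq_single_of_mem j hj fun k _ hk => by
      rw [intervalIntegral.integral_const_mul, integral_exp_int_mul, if_neg (sub_ne_zero.2 hk),
        mul_zero],
    intervalIntegral.integral_const_mul, integral_exp_int_mul, if_pos (sub_self j),
    ← Complex.conj_mul', Complex.star_def]
  have : (Real.pi : ℂ) ≠ 0 := by exact_mod_cast Real.pi_ne_zero
  field_simp

/-! ### Spectral decomposition of the symbol -/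

/-- The quasi-energy of the Hadamard walk at momentum `θ`. -/
def quasiEnergy (θ : ℝ) : ℝ := Real.arcsin (Real.sin θ / Real.sqrt 2)

lemma abs_sin_div_sqrt_two_lt_one (θ : ℝ) : |Real.sin θ / Real.sqrt 2| < 1 := by
  rw [abs_div, abs_of_pos (show (0 : ℝ) < Real.sqrt 2 by positivity), div_lt_one (by positivity)]
  refine (Real.abs_sin_le_one θ).trans_lt ?_
  rw [Real.lt_sqrt (by norm_num)]
  norm_num

lemma continuous_quasiEnergy : Continuous quasiEnergy :=
  Real.continuous_arcsin.comp (by fun_prop)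

lemma sin_quasiEnergy (θ : ℝ) : Real.sin (quasiEnergy θ) = Real.sin θ / Real.sqrt 2 := by
  have h := abs_lt.1 (abs_sin_div_sqrt_two_lt_one θ)
  exact Real.sin_arcsin h.1.le h.2.le

lemma cos_quasiEnergy_pos (θ : ℝ) : 0 < Real.cos (quasiEnergy θ) := by
  have h := abs_sin_div_sqrt_two_lt_one θ
  rw [quasiEnergy, Real.cos_arcsin, Real.sqrt_pos, sub_pos, ← sq_abs]
  exact pow_lt_one₀ (abs_nonneg _) h two_ne_zero

lemma hasDerivAt_quasiEnergy (θ : ℝ) : HasDerivAt quasiEnergy (groupVelocity θ) θ := by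
  have h := abs_lt.1 (abs_sin_div_sqrt_two_lt_one θ)
  have h2 : (0 : ℝ) < Real.sqrt 2 := by positivity
  convert! (Real.hasDerivAt_arcsin h.1.ne' h.2.ne).comp θ
    ((Real.hasDerivAt_sin θ).div_const (Real.sqrt 2)) using 1
  have : 1 - (Real.sin θ / Real.sqrt 2) ^ 2 = (1 + Real.cos θ ^ 2) / 2 := by
    rw [div_pow, Real.sq_sqrt (by norm_num), Real.cos_sq']
    ring
  rw [this, Real.sqrt_div (by positivity), groupVelocity]
  have : Real.sqrt (1 + Real.cos θ ^ 2) ≠ 0 := by positivity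
  field_simp

/-- The eigenvalue `e^{iω}` of the symbol. -/
def eigenvaluePos (θ : ℝ) : ℂ := Complex.exp (quasiEnergy θ * Complex.I)

/-- The eigenvalue `-e^{-iω}` of the symbol. -/
def eigenvalueNeg (θ : ℝ) : ℂ := -Complex.exp (-(quasiEnergy θ * Complex.I))

/-- The spectral projection of the symbol for `eigenvaluePos`. -/
def projPos (θ : ℝ) : Matrix (Fin 2) (Fin 2) ℂ :=
  (2 * (Real.cos (quasiEnergy θ) : ℂ))⁻¹ • (walkSymbol θ - eigenvalueNeg θ • 1)

/-- The spectral projection of the symbol for `eigenvalueNeg`. -/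
def projNeg (θ : ℝ) : Matrix (Fin 2) (Fin 2) ℂ :=
  (2 * (Real.cos (quasiEnergy θ) : ℂ))⁻¹ • (eigenvaluePos θ • 1 - walkSymbol θ)

lemma ofReal_sqrt_two_sq : (Real.sqrt 2 : ℂ) ^ 2 = 2 := by
  rw [← Complex.ofReal_pow, Real.sq_sqrt (by norm_num)]
  norm_num

lemma ofReal_sqrt_two_ne_zero : (Real.sqrt 2 : ℂ) ≠ 0 := by
  have : Real.sqrt 2 ≠ 0 := by positivity
  exact_mod_cast this

lemma eigenvaluePos_sub_eigenvalueNeg (θ : ℝ) :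
    eigenvaluePos θ - eigenvalueNeg θ = 2 * (Real.cos (quasiEnergy θ) : ℂ) := by
  rw [eigenvaluePos, eigenvalueNeg, Complex.ofReal_cos, Complex.two_cos, neg_mul]
  ring

lemma eigenvaluePos_mul_eigenvalueNeg (θ : ℝ) : eigenvaluePos θ * eigenvalueNeg θ = -1 := by
  rw [eigenvaluePos, eigenvalueNeg, mul_neg, ← Complex.exp_add]
  simp

lemma trace_walkSymbol (θ : ℝ) :
    (walkSymbol θ).trace = 2 * (Real.sin θ : ℂ) * Complex.I / (Real.sqrt 2 : ℂ) := by
  rw [Complex.ofReal_sin, Complex.two_sin, Matrix.trace_fin_two]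
  simp only [walkSymbol, Matrix.of_apply, Matrix.cons_val', Matrix.cons_val_zero,
    Matrix.cons_val_one, Matrix.cons_val_fin_one]
  linear_combination (Complex.exp (θ * Complex.I) - Complex.exp (-θ * Complex.I))
    / (Real.sqrt 2 : ℂ) * Complex.I_sq

lemma eigenvaluePos_add_eigenvalueNeg (θ : ℝ) :
    eigenvaluePos θ + eigenvalueNeg θ = (walkSymbol θ).trace := by
  have h : (Real.sin θ : ℂ) / (Real.sqrt 2 : ℂ) = Complex.sin (quasiEnergy θ : ℂ) := by
    rw [← Complex.ofReal_sin, sin_quasiEnergy]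
    push_cast
    rfl
  rw [trace_walkSymbol, mul_assoc, mul_comm _ Complex.I, mul_div_assoc, mul_div_assoc, h,
    eigenvaluePos, eigenvalueNeg]
  have h2 := Complex.two_sin (quasiEnergy θ : ℂ)
  rw [neg_mul] at h2
  linear_combination (-Complex.I) * h2 + (Complex.exp (quasiEnergy θ * Complex.I)
    - Complex.exp (-(quasiEnergy θ * Complex.I))) * Complex.I_sq

lemma walkSymbol_sq (θ : ℝ) :
    walkSymbol θ * walkSymbol θ = (walkSymbol θ).trace • walkSymbol θ + 1 := by
  have h1 : Complex.exp (θ * Complex.I) * Complex.exp (-θ * Complex.I) = 1 := by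
    rw [← Complex.exp_add]
    simp
  have h2 := ofReal_sqrt_two_sq
  have h3 := ofReal_sqrt_two_ne_zero
  ext a b
  rw [Matrix.trace_fin_two, Matrix.mul_apply, Fin.sum_univ_two]
  fin_cases a <;> fin_cases b <;> simp [walkSymbol] <;> field_simp <;> grind

lemma conjTranspose_walkSymbol_mul (θ : ℝ) :
    (walkSymbol θ).conjTranspose * walkSymbol θ = 1 := by
  have h1 : Complex.exp (θ * Complex.I) * Complex.exp (-θ * Complex.I) = 1 := by
    rw [← Complex.exp_add]
    simp
  have h2 := ofReal_sqrt_two_sq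
  have h3 := ofReal_sqrt_two_ne_zero
  ext a b
  rw [Matrix.mul_apply, Fin.sum_univ_two]
  fin_cases a <;> fin_cases b <;> simp [walkSymbol, ← Complex.exp_conj] <;> field_simp <;> grind

lemma two_mul_cos_quasiEnergy_ne_zero (θ : ℝ) : 2 * (Real.cos (quasiEnergy θ) : ℂ) ≠ 0 :=
  mul_ne_zero two_ne_zero (by exact_mod_cast (cos_quasiEnergy_pos θ).ne')

lemma projPos_add_projNeg (θ : ℝ) : projPos θ + projNeg θ = 1 := by
  have h : walkSymbol θ - eigenvalueNeg θ • 1 + (eigenvaluePos θ • 1 - walkSymbol θ)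
      = (eigenvaluePos θ - eigenvalueNeg θ) • (1 : Matrix (Fin 2) (Fin 2) ℂ) := by
    rw [sub_smul]
    abel
  rw [projPos, projNeg, ← smul_add, h, eigenvaluePos_sub_eigenvalueNeg, smul_smul,
    inv_mul_cancel₀ (two_mul_cos_quasiEnergy_ne_zero θ), one_smul]

lemma trace_projPos (θ : ℝ) : (projPos θ).trace = 1 := by
  rw [projPos, Matrix.trace_smul, Matrix.trace_sub, Matrix.trace_smul, Matrix.trace_one,
    ← eigenvaluePos_add_eigenvalueNeg, smul_eq_mul,
    inv_mul_eq_one₀ (two_mul_cos_quasiEnergy_ne_zero θ), ← eigenvaluePos_sub_eigenvalueNeg]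
  simp
  ring

lemma trace_projNeg (θ : ℝ) : (projNeg θ).trace = 1 := by
  have h := congrArg Matrix.trace (projPos_add_projNeg θ)
  rw [Matrix.trace_add, trace_projPos, Matrix.trace_one] at h
  simp only [Fintype.card_fin, Nat.cast_ofNat] at h
  linear_combination h

lemma walkSymbol_mul_projPos (θ : ℝ) :
    walkSymbol θ * projPos θ = eigenvaluePos θ • projPos θ := by
  have h : walkSymbol θ * (walkSymbol θ - eigenvalueNeg θ • 1)
      = eigenvaluePos θ • (walkSymbol θ - eigenvalueNeg θ • 1) := by
    rw [mul_sub, walkSymbol_sq, ← eigenvaluePos_add_eigenvalueNeg, smul_sub, smul_smul,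
      eigenvaluePos_mul_eigenvalueNeg, Matrix.mul_smul, mul_one, add_smul, neg_smul, one_smul]
    abel
  rw [projPos, Matrix.mul_smul, h, smul_comm]

lemma walkSymbol_mul_projNeg (θ : ℝ) :
    walkSymbol θ * projNeg θ = eigenvalueNeg θ • projNeg θ := by
  have h : walkSymbol θ * (eigenvaluePos θ • 1 - walkSymbol θ)
      = eigenvalueNeg θ • (eigenvaluePos θ • 1 - walkSymbol θ) := by
    rw [mul_sub, walkSymbol_sq, ← eigenvaluePos_add_eigenvalueNeg, smul_sub, smul_smul,
      mul_comm (eigenvalueNeg θ), eigenvaluePos_mul_eigenvalueNeg, Matrix.mul_smul, mul_one,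
      add_smul, neg_smul, one_smul]
    abel
  rw [projNeg, Matrix.mul_smul, h, smul_comm]

lemma pow_mul_of_mul_eq_smul {M P : Matrix (Fin 2) (Fin 2) ℂ} {z : ℂ} (h : M * P = z • P)
    (m : ℕ) : M ^ m * P = z ^ m • P := by
  induction m with
  | zero => simp
  | succ m ih => rw [pow_succ, mul_assoc, h, Matrix.mul_smul, ih, smul_smul, pow_succ']

lemma conjTranspose_walkSymbol_pow_mul (θ : ℝ) (m : ℕ) :
    (walkSymbol θ ^ m).conjTranspose * walkSymbol θ ^ m = 1 := by
  have hu : walkSymbol θ ∈ Matrix.unitaryGroup (Fin 2) ℂ := by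
    rw [Matrix.mem_unitaryGroup_iff']
    exact conjTranspose_walkSymbol_mul θ
  exact Matrix.mem_unitaryGroup_iff'.1 (pow_mem hu m)

lemma norm_walkSymbol_pow_apply_le (θ : ℝ) (m : ℕ) (a b : Fin 2) :
    ‖(walkSymbol θ ^ m) a b‖ ≤ 1 :=
  entry_norm_bound_of_unitary
    (Matrix.mem_unitaryGroup_iff'.2 (conjTranspose_walkSymbol_pow_mul θ m)) a b

lemma continuous_walkSymbol : Continuous walkSymbol := by
  refine continuous_matrix fun a b => ?_
  fin_cases a <;> fin_cases b <;> simp only [walkSymbol] <;> simp <;> fun_prop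

lemma continuous_eigenvaluePos : Continuous eigenvaluePos := by
  have := continuous_quasiEnergy
  unfold eigenvaluePos
  fun_prop

lemma continuous_eigenvalueNeg : Continuous eigenvalueNeg := by
  have := continuous_quasiEnergy
  unfold eigenvalueNeg
  fun_prop

lemma continuous_projPos : Continuous projPos := by
  have h := continuous_quasiEnergy
  have h1 := continuous_walkSymbol
  have h2 := continuous_eigenvalueNeg
  have h3 : Continuous fun θ => (2 * (Real.cos (quasiEnergy θ) : ℂ))⁻¹ :=
    Continuous.inv₀ (by fun_prop) two_mul_cos_quasiEnergy_ne_zero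
  unfold projPos
  fun_prop

lemma continuous_projNeg : Continuous projNeg := by
  have h := continuous_quasiEnergy
  have h1 := continuous_walkSymbol
  have h2 := continuous_eigenvaluePos
  have h3 : Continuous fun θ => (2 * (Real.cos (quasiEnergy θ) : ℂ))⁻¹ :=
    Continuous.inv₀ (by fun_prop) two_mul_cos_quasiEnergy_ne_zero
  unfold projNeg
  fun_prop

/-! ### Convergence of the characteristic functions -/

lemma conjTranspose_pow_mul_proj {θ : ℝ} {P : Matrix (Fin 2) (Fin 2) ℂ} {z : ℂ} (hz : z ≠ 0)
    (h : walkSymbol θ * P = z • P) (m : ℕ) :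
    (walkSymbol θ ^ m).conjTranspose * P = (z ^ m)⁻¹ • P := by
  have h1 : (walkSymbol θ ^ m).conjTranspose * (walkSymbol θ ^ m * P) = P := by
    rw [← mul_assoc, conjTranspose_walkSymbol_pow_mul, one_mul]
  rw [pow_mul_of_mul_eq_smul h, Matrix.mul_smul] at h1
  rw [← h1, smul_smul, inv_mul_cancel₀ (pow_ne_zero m hz), one_smul, h1]

lemma norm_trace_conjTranspose_pow_mul_le (θ : ℝ) (m : ℕ) (B : Matrix (Fin 2) (Fin 2) ℂ) :
    ‖((walkSymbol θ ^ m).conjTranspose * B).trace‖ ≤ ∑ a, ∑ b, ‖B a b‖ := by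
  rw [Matrix.trace, Finset.sum_comm]
  refine (norm_sum_le _ _).trans (Finset.sum_le_sum fun b _ => ?_)
  rw [Matrix.diag_apply, Matrix.mul_apply]
  refine (norm_sum_le _ _).trans (Finset.sum_le_sum fun a _ => ?_)
  rw [norm_mul, Matrix.conjTranspose_apply, norm_star]
  exact mul_le_of_le_one_left (norm_nonneg _) (norm_walkSymbol_pow_apply_le θ m a b)

lemma eigenvaluePos_ne_zero (θ : ℝ) : eigenvaluePos θ ≠ 0 := Complex.exp_ne_zero _

lemma eigenvalueNeg_ne_zero (θ : ℝ) : eigenvalueNeg θ ≠ 0 := neg_ne_zero.2 (Complex.exp_ne_zero _)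

lemma norm_eigenvaluePos (θ : ℝ) : ‖eigenvaluePos θ‖ = 1 := Complex.norm_exp_ofReal_mul_I _

lemma norm_eigenvalueNeg (θ : ℝ) : ‖eigenvalueNeg θ‖ = 1 := by
  rw [eigenvalueNeg, norm_neg, ← neg_mul, ← Complex.ofReal_neg, Complex.norm_exp_ofReal_mul_I]

lemma eigenvaluePos_pow_mul_inv (θ θ' : ℝ) (m : ℕ) :
    eigenvaluePos θ' ^ m * (eigenvaluePos θ ^ m)⁻¹
      = Complex.exp ((m * (quasiEnergy θ' - quasiEnergy θ) : ℝ) * Complex.I) := by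
  rw [← div_eq_mul_inv, ← div_pow, eigenvaluePos, eigenvaluePos, ← Complex.exp_sub,
    ← Complex.exp_nat_mul]
  push_cast
  ring_nf

lemma eigenvalueNeg_pow_mul_inv (θ θ' : ℝ) (m : ℕ) :
    eigenvalueNeg θ' ^ m * (eigenvalueNeg θ ^ m)⁻¹
      = Complex.exp (-((m * (quasiEnergy θ' - quasiEnergy θ) : ℝ) * Complex.I)) := by
  rw [← div_eq_mul_inv, ← div_pow, eigenvalueNeg, eigenvalueNeg, neg_div_neg_eq,
    ← Complex.exp_sub, ← Complex.exp_nat_mul]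
  push_cast
  ring_nf

/-- The trace of the propagator between momenta `θ` and `θ'`, up to a small error. -/
lemma norm_trace_sub_le (θ θ' : ℝ) (m : ℕ) :
    ‖((walkSymbol θ ^ m).conjTranspose * walkSymbol θ' ^ m).trace
      - (Complex.exp ((m * (quasiEnergy θ' - quasiEnergy θ) : ℝ) * Complex.I)
        + Complex.exp (-((m * (quasiEnergy θ' - quasiEnergy θ) : ℝ) * Complex.I)))‖
      ≤ (∑ a, ∑ b, ‖(projPos θ' - projPos θ) a b‖)
        + ∑ a, ∑ b, ‖(projNeg θ' - projNeg θ) a b‖ := by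
  set A := (walkSymbol θ ^ m).conjTranspose with hA
  have hM : walkSymbol θ' ^ m
      = eigenvaluePos θ' ^ m • projPos θ' + eigenvalueNeg θ' ^ m • projNeg θ' := by
    rw [← pow_mul_of_mul_eq_smul (walkSymbol_mul_projPos θ'),
      ← pow_mul_of_mul_eq_smul (walkSymbol_mul_projNeg θ'), ← mul_add, projPos_add_projNeg, mul_one]
  have h1 : (A * projPos θ).trace = (eigenvaluePos θ ^ m)⁻¹ := by
    rw [hA, conjTranspose_pow_mul_proj (eigenvaluePos_ne_zero θ) (walkSymbol_mul_projPos θ),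
      Matrix.trace_smul, trace_projPos, smul_eq_mul, mul_one]
  have h2 : (A * projNeg θ).trace = (eigenvalueNeg θ ^ m)⁻¹ := by
    rw [hA, conjTranspose_pow_mul_proj (eigenvalueNeg_ne_zero θ) (walkSymbol_mul_projNeg θ),
      Matrix.trace_smul, trace_projNeg, smul_eq_mul, mul_one]
  have hdiff : (A * walkSymbol θ' ^ m).trace
      - (Complex.exp ((m * (quasiEnergy θ' - quasiEnergy θ) : ℝ) * Complex.I)
        + Complex.exp (-((m * (quasiEnergy θ' - quasiEnergy θ) : ℝ) * Complex.I)))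
      = eigenvaluePos θ' ^ m * (A * (projPos θ' - projPos θ)).trace
        + eigenvalueNeg θ' ^ m * (A * (projNeg θ' - projNeg θ)).trace := by
    rw [← eigenvaluePos_pow_mul_inv, ← eigenvalueNeg_pow_mul_inv, hM, mul_add, Matrix.trace_add,
      Matrix.mul_smul, Matrix.mul_smul, Matrix.trace_smul, Matrix.trace_smul, mul_sub, mul_sub,
      Matrix.trace_sub, Matrix.trace_sub, h1, h2, smul_eq_mul, smul_eq_mul]
    ring
  rw [hdiff]
  refine (norm_add_le _ _).trans (add_le_add ?_ ?_)
  · rw [norm_mul, norm_pow, norm_eigenvaluePos, one_pow, one_mul]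
    exact norm_trace_conjTranspose_pow_mul_le θ m _
  · rw [norm_mul, norm_pow, norm_eigenvalueNeg, one_pow, one_mul]
    exact norm_trace_conjTranspose_pow_mul_le θ m _

lemma tendsto_trace_propagator {m : ℕ → ℕ} {s : ℕ → ℝ} {t : ℝ} (hs : Tendsto s atTop (𝓝 0))
    (hms : Tendsto (fun n => m n * s n) atTop (𝓝 t)) (ξ θ : ℝ) :
    Tendsto (fun n => ((walkSymbol θ ^ m n).conjTranspose * walkSymbol (θ + ξ * s n) ^ m n).trace)
      atTop (𝓝 (Complex.exp ((ξ * (t * groupVelocity θ) : ℝ) * Complex.I)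
        + Complex.exp (-((ξ * (t * groupVelocity θ) : ℝ) * Complex.I)))) := by
  have hθ : Tendsto (fun n => θ + ξ * s n) atTop (𝓝 θ) := by
    simpa using (hs.const_mul ξ).const_add θ
  have hphase : Tendsto (fun n => (m n : ℝ) * (quasiEnergy (θ + ξ * s n) - quasiEnergy θ)) atTop
      (𝓝 (ξ * (t * groupVelocity θ))) := by
    have hd := hasDerivAt_quasiEnergy θ
    have hslope : Tendsto (fun n => dslope quasiEnergy θ (θ + ξ * s n)) atTop
        (𝓝 (groupVelocity θ)) := by
      have hc := (continuousAt_dslope_same.2 hd.differentiableAt).tendsto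
      rw [dslope_same, hd.deriv] at hc
      exact hc.comp hθ
    have := (hms.mul hslope).const_mul ξ
    refine this.congr fun n => ?_
    rw [← sub_smul_dslope quasiEnergy θ (θ + ξ * s n), smul_eq_mul, add_sub_cancel_left]
    ring
  have hproj : ∀ P : ℝ → Matrix (Fin 2) (Fin 2) ℂ, Continuous P →
      Tendsto (fun n => ∑ a, ∑ b, ‖(P (θ + ξ * s n) - P θ) a b‖) atTop (𝓝 0) := by
    intro P hP
    have hc : Continuous fun θ' => ∑ a, ∑ b, ‖(P θ' - P θ) a b‖ := by fun_prop
    simpa [Function.comp_def] using (hc.tendsto θ).comp hθ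
  have hzero := squeeze_zero_norm (fun n => norm_trace_sub_le θ (θ + ξ * s n) (m n))
    (by simpa using (hproj _ continuous_projPos).add (hproj _ continuous_projNeg))
  have hmain : Tendsto (fun n =>
      Complex.exp ((m n * (quasiEnergy (θ + ξ * s n) - quasiEnergy θ) : ℝ) * Complex.I)
        + Complex.exp (-((m n * (quasiEnergy (θ + ξ * s n) - quasiEnergy θ) : ℝ) * Complex.I)))
      atTop (𝓝 (Complex.exp ((ξ * (t * groupVelocity θ) : ℝ) * Complex.I)
        + Complex.exp (-((ξ * (t * groupVelocity θ) : ℝ) * Complex.I)))) := by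
    have hc : Continuous fun x : ℝ =>
        Complex.exp (x * Complex.I) + Complex.exp (-(x * Complex.I)) := by fun_prop
    exact (hc.tendsto _).comp hphase
  simpa using hzero.add hmain

lemma groupVelocity_neg (θ : ℝ) : groupVelocity (-θ) = groupVelocity θ := by
  simp [groupVelocity]

lemma groupVelocity_pi_sub (θ : ℝ) : groupVelocity (Real.pi - θ) = -groupVelocity θ := by
  simp [groupVelocity, neg_div]

lemma integral_groupVelocity_symm {g : ℝ → ℂ} (hg : Continuous g) :
    ∫ θ in (-Real.pi)..Real.pi, (g (groupVelocity θ) + g (-groupVelocity θ))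
      = 4 * ∫ θ in Set.Ioo 0 Real.pi, g (groupVelocity θ) := by
  have hv := continuous_groupVelocity
  have hi : ∀ a b, IntervalIntegrable (fun θ => g (groupVelocity θ)) volume a b := fun a b =>
    (hg.comp hv).intervalIntegrable a b
  have hi' : ∀ a b, IntervalIntegrable (fun θ => g (-groupVelocity θ)) volume a b := fun a b =>
    (hg.comp hv.neg).intervalIntegrable a b
  have h1 := intervalIntegral.integral_comp_neg (a := 0) (b := Real.pi)
    fun θ => g (groupVelocity θ)
  have h2 := intervalIntegral.integral_comp_neg (a := 0) (b := Real.pi)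
    fun θ => g (-groupVelocity θ)
  have h3 := intervalIntegral.integral_comp_sub_left (a := 0) (b := Real.pi)
    (fun θ => g (groupVelocity θ)) Real.pi
  simp only [groupVelocity_neg, groupVelocity_pi_sub, neg_zero, sub_self, sub_zero] at h1 h2 h3
  rw [intervalIntegral.integral_add (hi _ _) (hi' _ _),
    ← intervalIntegral.integral_add_adjacent_intervals (hi (-Real.pi) 0) (hi 0 Real.pi),
    ← intervalIntegral.integral_add_adjacent_intervals (hi' (-Real.pi) 0) (hi' 0 Real.pi),
    ← h1, ← h2, h3, intervalIntegral.integral_of_le Real.pi_pos.le, integral_Ioc_eq_integral_Ioo]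
  ring

lemma continuous_trace_propagator (m : ℕ) (ξ : ℝ) :
    Continuous fun θ => ((walkSymbol θ ^ m).conjTranspose * walkSymbol (θ + ξ) ^ m).trace := by
  have h := continuous_walkSymbol
  fun_prop

lemma tendsto_integral_trace_propagator {m : ℕ → ℕ} {s : ℕ → ℝ} {t : ℝ}
    (hs : Tendsto s atTop (𝓝 0)) (hms : Tendsto (fun n => m n * s n) atTop (𝓝 t)) (ξ : ℝ) :
    Tendsto (fun n => ∫ θ in (-Real.pi)..Real.pi,
        ((walkSymbol θ ^ m n).conjTranspose * walkSymbol (θ + ξ * s n) ^ m n).trace) atTop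
      (𝓝 (4 * ∫ θ in Set.Ioo 0 Real.pi,
        Complex.exp ((ξ * (t * groupVelocity θ) : ℝ) * Complex.I))) := by
  have hg : Continuous fun v : ℝ => Complex.exp ((ξ * (t * v) : ℝ) * Complex.I) := by fun_prop
  rw [← integral_groupVelocity_symm hg]
  refine intervalIntegral.tendsto_integral_filter_of_dominated_convergence (fun _ => 4)
    (Eventually.of_forall fun n => (continuous_trace_propagator _ _).aestronglyMeasurable)
    (Eventually.of_forall fun n => ae_of_all _ fun θ _ => ?_) (by simp)
    (ae_of_all _ fun θ _ => ?_)
  · refine (norm_trace_conjTranspose_pow_mul_le θ _ _).trans ?_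
    have h : ∀ a b, ‖(walkSymbol (θ + ξ * s n) ^ m n) a b‖ ≤ 1 :=
      norm_walkSymbol_pow_apply_le _ _
    simp only [Fin.sum_univ_two]
    linarith [h 0 0, h 0 1, h 1 0, h 1 1]
  · convert! tendsto_trace_propagator hs hms ξ θ using 4
    push_cast
    ring

/-! ### The position distribution -/

/-- The probability that the walk started at `k` with a uniform coin is at `j` at time `m`. -/
def walkProb (U : QWState →ₗ[ℂ] QWState) (m : ℕ) (k j : ℤ) : ℝ :=
  (1 / 2) * ‖((U ^ m) (deltaCoin k 0)) j‖ ^ 2 + (1 / 2) * ‖((U ^ m) (deltaCoin k 1)) j‖ ^ 2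

lemma walkProb_nonneg (U : QWState →ₗ[ℂ] QWState) (m : ℕ) (k j : ℤ) : 0 ≤ walkProb U m k j := by
  unfold walkProb
  positivity

namespace IsHadamardWalk

variable {U : QWState →ₗ[ℂ] QWState}

lemma walkProb_translate (hU : IsHadamardWalk U) (m : ℕ) (k j : ℤ) :
    walkProb U m k j = walkProb U m 0 (j - k) := by
  simp only [walkProb, hU.pow_deltaCoin_translate m k]

lemma walkProb_eq_zero (hU : IsHadamardWalk U) (m : ℕ) (j : ℤ)
    (hj : j ∉ Finset.Icc (-(m : ℤ)) m) : walkProb U m 0 j = 0 := by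
  have h := fun c => hU.pow_deltaCoin_eq_zero m c j ((Int.notMem_Icc_neg_iff m j).1 hj)
  simp [walkProb, h]

lemma sum_pow_deltaCoin (hU : IsHadamardWalk U) (m : ℕ) (c b : Fin 2) (θ : ℝ) :
    ∑ j ∈ Finset.Icc (-(m : ℤ)) m,
      (U ^ m) (deltaCoin 0 c) j b * Complex.exp (j * θ * Complex.I) = (walkSymbol θ ^ m) b c := by
  rw [← hU.tsum_pow_deltaCoin, tsum_eq_sum]
  intro j hj
  rw [hU.pow_deltaCoin_eq_zero m c j ((Int.notMem_Icc_neg_iff m j).1 hj)]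
  simp

lemma sum_walkProb_mul_exp (hU : IsHadamardWalk U) (m : ℕ) (ξ : ℝ) :
    ∑ j ∈ Finset.Icc (-(m : ℤ)) m, (walkProb U m 0 j : ℂ) * Complex.exp (j * ξ * Complex.I)
      = 1 / (4 * Real.pi) * ∫ θ in (-Real.pi)..Real.pi,
        ((walkSymbol θ ^ m).conjTranspose * walkSymbol (θ + ξ) ^ m).trace := by
  have hpars : ∀ c b : Fin 2, ∑ j ∈ Finset.Icc (-(m : ℤ)) m,
      (‖(U ^ m) (deltaCoin 0 c) j b‖ : ℂ) ^ 2 * Complex.exp (j * ξ * Complex.I)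
      = 1 / (2 * Real.pi) * ∫ θ in (-Real.pi)..Real.pi,
        star ((walkSymbol θ ^ m) b c) * (walkSymbol (θ + ξ) ^ m) b c := by
    intro c b
    rw [sum_norm_sq_mul_exp]
    simp_rw [hU.sum_pow_deltaCoin]
  have hcont := continuous_walkSymbol
  have hint : ∀ c b : Fin 2, IntervalIntegrable
      (fun θ => star ((walkSymbol θ ^ m) b c) * (walkSymbol (θ + ξ) ^ m) b c) volume
      (-Real.pi) Real.pi := fun c b => Continuous.intervalIntegrable (by fun_prop) _ _
  have htrace : ∀ θ : ℝ, ((walkSymbol θ ^ m).conjTranspose * walkSymbol (θ + ξ) ^ m).trace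
      = ∑ c, ∑ b, star ((walkSymbol θ ^ m) b c) * (walkSymbol (θ + ξ) ^ m) b c := fun θ => rfl
  simp_rw [htrace]
  rw [intervalIntegral.integral_finsetSum fun c _ =>
    Continuous.intervalIntegrable (by fun_prop) _ _]
  simp_rw [intervalIntegral.integral_finsetSum fun b _ => hint _ b]
  have hprob : ∀ j : ℤ, (walkProb U m 0 j : ℂ) = 1 / 2 *
      ∑ c, ∑ b, (‖(U ^ m) (deltaCoin 0 c) j b‖ : ℂ) ^ 2 := by
    intro j
    simp only [walkProb, EuclideanSpace.norm_sq_eq, Fin.sum_univ_two]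
    push_cast
    ring
  have hswap : ∑ j ∈ Finset.Icc (-(m : ℤ)) m,
      (walkProb U m 0 j : ℂ) * Complex.exp (j * ξ * Complex.I)
      = 1 / 2 * ∑ c, ∑ b, ∑ j ∈ Finset.Icc (-(m : ℤ)) m,
        (‖(U ^ m) (deltaCoin 0 c) j b‖ : ℂ) ^ 2 * Complex.exp (j * ξ * Complex.I) := by
    simp only [hprob, Fin.sum_univ_two, ← Finset.sum_add_distrib, Finset.mul_sum]
    refine Finset.sum_congr rfl fun j _ => ?_
    ring
  rw [hswap]
  simp_rw [hpars]
  simp only [Fin.sum_univ_two]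
  ring

lemma sum_walkProb (hU : IsHadamardWalk U) (m : ℕ) :
    ∑ j ∈ Finset.Icc (-(m : ℤ)) m, walkProb U m 0 j = 1 := by
  have h := hU.sum_walkProb_mul_exp m 0
  simp only [add_zero, conjTranspose_walkSymbol_pow_mul, Matrix.trace_one] at h
  have hpi : (Real.pi : ℂ) ≠ 0 := by exact_mod_cast Real.pi_ne_zero
  have h' : ∑ j ∈ Finset.Icc (-(m : ℤ)) m, (walkProb U m 0 j : ℂ) = 1 := by
    simp at h
    rw [h]
    field_simp
    norm_num
  exact_mod_cast h'

end IsHadamardWalk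

/-- The law of the position, scaled by `s`, of the walk started at the origin with a uniform coin,
at time `m`. -/
def walkLaw (U : QWState →ₗ[ℂ] QWState) (m : ℕ) (s : ℝ) : Measure ℝ :=
  ∑ j ∈ Finset.Icc (-(m : ℤ)) m, ENNReal.ofReal (walkProb U m 0 j) • Measure.dirac (j * s)

lemma IsHadamardWalk.isProbabilityMeasure_walkLaw {U : QWState →ₗ[ℂ] QWState}
    (hU : IsHadamardWalk U) (m : ℕ) (s : ℝ) : IsProbabilityMeasure (walkLaw U m s) := by
  constructor
  simp only [walkLaw, Measure.coe_finsetSum, Finset.sum_apply, Measure.smul_apply, measure_univ,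
    smul_eq_mul, mul_one]
  rw [← ENNReal.ofReal_sum_of_nonneg fun j _ => walkProb_nonneg U m 0 j, hU.sum_walkProb,
    ENNReal.ofReal_one]

lemma integral_walkLaw {E : Type*} [NormedAddCommGroup E] [NormedSpace ℝ E] [CompleteSpace E]
    (U : QWState →ₗ[ℂ] QWState) (m : ℕ) (s : ℝ) (f : ℝ → E) :
    ∫ x, f x ∂(walkLaw U m s)
      = ∑ j ∈ Finset.Icc (-(m : ℤ)) m, walkProb U m 0 j • f (j * s) := by
  rw [walkLaw, integral_finsetSum_measure fun j _ => ?_]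
  · refine Finset.sum_congr rfl fun j _ => ?_
    rw [integral_smul_measure, integral_dirac, ENNReal.toReal_ofReal (walkProb_nonneg U m 0 j)]
  · exact (integrable_dirac (by simp)).smul_measure ENNReal.ofReal_ne_top

/-- The law of `t * groupVelocity θ` for `θ` uniform on `(0, π)`. -/
def velocityLaw (t : ℝ) : Measure ℝ :=
  (ENNReal.ofReal (1 / Real.pi) • volume.restrict (Set.Ioo 0 Real.pi)).map
    fun θ => t * groupVelocity θ

lemma measurable_const_mul_groupVelocity (t : ℝ) : Measurable fun θ => t * groupVelocity θ :=
  (continuous_groupVelocity.const_mul t).measurable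

instance isProbabilityMeasure_velocityLaw (t : ℝ) : IsProbabilityMeasure (velocityLaw t) := by
  refine ⟨?_⟩
  rw [velocityLaw, Measure.map_apply (measurable_const_mul_groupVelocity t) MeasurableSet.univ]
  simp only [Set.preimage_univ, Measure.smul_apply, Measure.restrict_apply_univ, Real.volume_Ioo,
    sub_zero, smul_eq_mul]
  rw [← ENNReal.ofReal_mul (by positivity), one_div_mul_cancel Real.pi_ne_zero, ENNReal.ofReal_one]

lemma integral_velocityLaw {E : Type*} [NormedAddCommGroup E] [NormedSpace ℝ E]
    (t : ℝ) {f : ℝ → E} (hf : StronglyMeasurable f) :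
    ∫ x, f x ∂(velocityLaw t)
      = (1 / Real.pi) • ∫ θ in Set.Ioo 0 Real.pi, f (t * groupVelocity θ) := by
  rw [velocityLaw, integral_map (measurable_const_mul_groupVelocity t).aemeasurable
    hf.aestronglyMeasurable, integral_smul_measure, ENNReal.toReal_ofReal (by positivity)]

/-- Weak convergence of the rescaled Hadamard walk (Konno's theorem). -/
lemma IsHadamardWalk.tendsto_walkLaw {U : QWState →ₗ[ℂ] QWState} (hU : IsHadamardWalk U)
    {m : ℕ → ℕ} {s : ℕ → ℝ} {t : ℝ} (hs : Tendsto s atTop (𝓝 0))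
    (hms : Tendsto (fun n => m n * s n) atTop (𝓝 t)) :
    Tendsto (β := ProbabilityMeasure ℝ)
      (fun n => ⟨walkLaw U (m n) (s n), hU.isProbabilityMeasure_walkLaw (m n) (s n)⟩) atTop
      (𝓝 ⟨velocityLaw t, isProbabilityMeasure_velocityLaw t⟩) := by
  refine ProbabilityMeasure.tendsto_of_tendsto_charFun fun ξ => ?_
  have hlim := (tendsto_integral_trace_propagator hs hms ξ).const_mul (1 / (4 * Real.pi) : ℂ)
  simp only [ProbabilityMeasure.coe_mk, charFun_apply_real]
  convert! hlim using 1
  · ext n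
    rw [← hU.sum_walkProb_mul_exp, integral_walkLaw]
    refine Finset.sum_congr rfl fun j _ => ?_
    rw [Complex.real_smul]
    push_cast
    ring_nf
  · rw [integral_velocityLaw t (by fun_prop : Continuous _).stronglyMeasurable, Complex.real_smul]
    push_cast
    rw [← mul_assoc (1 / (4 * (Real.pi : ℂ)))]
    congr 2
    ring

/-! ### Convergence of the mean -/

lemma exists_forall_lt_abs_eq_zero {g : ℝ → ℝ} (hg : HasCompactSupport g) :
    ∃ R : ℝ, ∀ x, R < |x| → g x = 0 := by
  obtain ⟨R, hR⟩ := hg.isBounded.subset_closedBall 0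
  refine ⟨R, fun x hx => image_eq_zero_of_notMem_tsupport fun h => ?_⟩
  have := hR h
  rw [mem_closedBall_zero_iff, Real.norm_eq_abs] at this
  linarith

lemma finite_support_comp_div {g : ℝ → ℝ} (hg : HasCompactSupport g) {n : ℕ} (hn : 1 ≤ n) :
    (Function.support fun k : ℤ => g ((k : ℝ) / n)).Finite := by
  obtain ⟨R, hR⟩ := exists_forall_lt_abs_eq_zero hg
  have hn' : (0 : ℝ) < n := by exact_mod_cast hn
  refine (Set.finite_Icc (-⌈n * R⌉) ⌈n * R⌉).subset fun k hk => ?_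
  rw [Function.mem_support] at hk
  have h : |(k : ℝ) / n| ≤ R := not_lt.1 fun h => hk (hR _ h)
  rw [abs_div, abs_of_pos hn', div_le_iff₀ hn', mul_comm] at h
  have h2 : (|k| : ℤ) ≤ ⌈n * R⌉ := by
    have : ((|k| : ℤ) : ℝ) ≤ (⌈n * R⌉ : ℤ) := by
      push_cast
      exact h.trans (Int.le_ceil _)
    exact_mod_cast this
  exact Set.mem_Icc.2 (abs_le.1 h2)

/-- A Riemann sum as the integral of a step function. -/
lemma integral_comp_floor_mul {g : ℤ → ℝ} (hg : g.support.Finite) {n : ℕ} (hn : 1 ≤ n) :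
    ∫ y : ℝ, g ⌊(n : ℝ) * y⌋ = (1 / (n : ℝ)) * ∑' k, g k := by
  have hn' : (0 : ℝ) < n := by exact_mod_cast hn
  have hstep : ∀ y : ℝ, g ⌊(n : ℝ) * y⌋ = ∑ k ∈ hg.toFinset,
      (Set.Ico ((k : ℝ) / n) ((k + 1 : ℝ) / n)).indicator (fun _ => g k) y := by
    intro y
    have hmem : ∀ k : ℤ, y ∈ Set.Ico ((k : ℝ) / n) ((k + 1 : ℝ) / n) ↔ ⌊(n : ℝ) * y⌋ = k := by
      intro k
      rw [Int.floor_eq_iff, Set.mem_Ico, div_le_iff₀' hn', lt_div_iff₀' hn']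
    simp only [Set.indicator_apply, hmem, Finset.sum_ite_eq, Set.Finite.mem_toFinset,
      Function.mem_support]
    split_ifs with h
    · rfl
    · exact not_not.1 h
  simp_rw [hstep]
  rw [integral_finsetSum _ fun k _ =>
      (integrable_indicator_iff measurableSet_Ico).2 (integrableOn_const (by simp)),
    tsum_eq_sum (s := hg.toFinset) (fun k hk => by simpa using hk), Finset.mul_sum]
  refine Finset.sum_congr rfl fun k _ => ?_
  rw [integral_indicator_const _ measurableSet_Ico, Real.volume_real_Ico_of_le (by gcongr; simp),
    smul_eq_mul]
  ring

lemma abs_floor_mul_div_sub_le (y : ℝ) {n : ℕ} (hn : 1 ≤ n) :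
    |(⌊(n : ℝ) * y⌋ : ℝ) / n - y| ≤ 1 / n := by
  have hn' : (0 : ℝ) < n := by exact_mod_cast hn
  have h1 := Int.floor_le ((n : ℝ) * y)
  have h2 := Int.lt_floor_add_one ((n : ℝ) * y)
  have h3 : (⌊(n : ℝ) * y⌋ : ℝ) / n - y = (⌊(n : ℝ) * y⌋ - n * y) / n := by field_simp
  rw [h3, abs_div, abs_of_pos hn', div_le_div_iff_of_pos_right hn', abs_le]
  constructor <;> linarith

lemma tendsto_floor_mul_div (y : ℝ) :
    Tendsto (fun n : ℕ => (⌊(n : ℝ) * y⌋ : ℝ) / n) atTop (𝓝 y) := by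
  refine tendsto_iff_dist_tendsto_zero.2 (squeeze_zero' (Eventually.of_forall fun n => dist_nonneg)
    ?_ tendsto_one_div_atTop_nhds_zero_nat)
  filter_upwards [eventually_ge_atTop 1] with n hn
  exact abs_floor_mul_div_sub_le y hn

namespace IsHadamardWalk

variable {U : QWState →ₗ[ℂ] QWState}

lemma tsum_mul_walkProb (hU : IsHadamardWalk U) (m n : ℕ) (k : ℤ) (H : ℝ → ℝ) :
    ∑' j : ℤ, H ((j : ℝ) / n) * walkProb U m k j
      = ∫ x, H ((k : ℝ) / n + x) ∂(walkLaw U m (1 / n)) := by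
  rw [integral_walkLaw, ← (Equiv.addRight k).tsum_eq, tsum_eq_sum (s := Finset.Icc (-(m : ℤ)) m)]
  · refine Finset.sum_congr rfl fun j _ => ?_
    rw [hU.walkProb_translate, Equiv.coe_addRight, add_sub_cancel_right, mul_comm, smul_eq_mul]
    push_cast
    ring_nf
  · intro j hj
    rw [hU.walkProb_translate, Equiv.coe_addRight, add_sub_cancel_right,
      hU.walkProb_eq_zero m j hj, mul_zero]

lemma tsum_mul_tsum_mul_walkProb (hU : IsHadamardWalk U) (m : ℕ) {n : ℕ} (hn : 1 ≤ n)
    {γ H : ℝ → ℝ} (hγ : HasCompactSupport γ) (hH : HasCompactSupport H) :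
    (1 / (n : ℝ)) * ∑' j : ℤ, H ((j : ℝ) / n) * ∑' k : ℤ, γ ((k : ℝ) / n) * walkProb U m k j
      = ∫ y : ℝ, γ ((⌊(n : ℝ) * y⌋ : ℝ) / n)
          * ∫ x, H ((⌊(n : ℝ) * y⌋ : ℝ) / n + x) ∂(walkLaw U m (1 / n)) := by
  have hγn := finite_support_comp_div hγ hn
  have hHn := finite_support_comp_div hH hn
  rw [integral_comp_floor_mul (g := fun k : ℤ => γ ((k : ℝ) / n)
    * ∫ x, H ((k : ℝ) / n + x) ∂(walkLaw U m (1 / n)))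
    (hγn.subset (Function.support_mul_subset_left _ _)) hn]
  congr 1
  have hγ0 : ∀ k ∉ hγn.toFinset, γ ((k : ℝ) / n) = 0 := fun k hk => by simpa using hk
  have hH0 : ∀ k ∉ hHn.toFinset, H ((k : ℝ) / n) = 0 := fun k hk => by simpa using hk
  simp_rw [← hU.tsum_mul_walkProb]
  rw [tsum_eq_sum (s := hHn.toFinset) fun j hj => by rw [hH0 j hj, zero_mul],
    tsum_eq_sum (s := hγn.toFinset) fun k hk => by rw [hγ0 k hk, zero_mul]]
  have h1 : ∀ j, ∑' k : ℤ, γ ((k : ℝ) / n) * walkProb U m k j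
      = ∑ k ∈ hγn.toFinset, γ ((k : ℝ) / n) * walkProb U m k j := fun j =>
    tsum_eq_sum fun k hk => by rw [hγ0 k hk, zero_mul]
  have h2 : ∀ k, ∑' j : ℤ, H ((j : ℝ) / n) * walkProb U m k j
      = ∑ j ∈ hHn.toFinset, H ((j : ℝ) / n) * walkProb U m k j := fun k =>
    tsum_eq_sum fun j hj => by rw [hH0 j hj, zero_mul]
  simp_rw [h1, h2, Finset.mul_sum]
  rw [Finset.sum_comm]
  refine Finset.sum_congr rfl fun k _ => Finset.sum_congr rfl fun j _ => ?_
  ring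

lemma tendsto_integral_walkLaw_translate (hU : IsHadamardWalk U) {m : ℕ → ℕ} {s a : ℕ → ℝ}
    {t y : ℝ} (hs : Tendsto s atTop (𝓝 0)) (hms : Tendsto (fun n => m n * s n) atTop (𝓝 t))
    (ha : Tendsto a atTop (𝓝 y)) {H : ℝ → ℝ} (hH : Continuous H) (hHs : HasCompactSupport H) :
    Tendsto (fun n => ∫ x, H (a n + x) ∂(walkLaw U (m n) (s n))) atTop
      (𝓝 (∫ x, H (y + x) ∂(velocityLaw t))) := by
  have := fun n => hU.isProbabilityMeasure_walkLaw (m n) (s n)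
  obtain ⟨C, hC⟩ := hHs.exists_bound_of_continuous hH
  have hweak : Tendsto (fun n => ∫ x, H (y + x) ∂(walkLaw U (m n) (s n))) atTop
      (𝓝 (∫ x, H (y + x) ∂(velocityLaw t))) :=
    ProbabilityMeasure.tendsto_iff_forall_integral_tendsto.1 (hU.tendsto_walkLaw hs hms)
      (BoundedContinuousFunction.ofNormedAddCommGroup (fun x => H (y + x)) (by fun_prop) C
        fun x => hC _)
  have hint : ∀ n b, Integrable (fun x => H (b + x)) (walkLaw U (m n) (s n)) := fun n b =>
    Integrable.of_bound (by fun_prop : Continuous _).aestronglyMeasurable C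
      (ae_of_all _ fun x => hC _)
  have hdiff : Tendsto (fun n => ∫ x, H (a n + x) ∂(walkLaw U (m n) (s n))
      - ∫ x, H (y + x) ∂(walkLaw U (m n) (s n))) atTop (𝓝 0) := by
    rw [Metric.tendsto_nhds]
    intro ε hε
    obtain ⟨δ, hδ, hunif⟩ := Metric.uniformContinuous_iff.1
      (hHs.uniformContinuous_of_continuous hH) (ε / 2) (half_pos hε)
    filter_upwards [Metric.tendsto_nhds.1 ha δ hδ] with n hn
    rw [dist_zero_right, ← integral_sub (hint n _) (hint n _)]
    refine lt_of_le_of_lt (norm_integral_le_of_norm_le_const (C := ε / 2)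
      (ae_of_all _ fun x => ?_)) ?_
    · rw [← dist_eq_norm]
      exact (hunif (by simpa using hn)).le
    · simpa using half_lt_self hε
  simpa using hdiff.add hweak

lemma tendsto_mean (hU : IsHadamardWalk U) {γ H : ℝ → ℝ} (hγ : Continuous γ)
    (hγs : HasCompactSupport γ) (hH : Continuous H) (hHs : HasCompactSupport H) {t : ℝ}
    (ht : 0 < t) :
    Tendsto (fun n : ℕ => (1 / (n : ℝ)) * ∑' j : ℤ, H ((j : ℝ) / n)
        * ∑' k : ℤ, γ ((k : ℝ) / n) * walkProb U ⌊t * n⌋₊ k j) atTop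
      (𝓝 (∫ x, H x * ∫ y, γ y * ((1 / t) * konno ((x - y) / t)))) := by
  have hs : Tendsto (fun n : ℕ => 1 / (n : ℝ)) atTop (𝓝 0) := tendsto_one_div_atTop_nhds_zero_nat
  have hms : Tendsto (fun n : ℕ => (⌊t * n⌋₊ : ℝ) * (1 / n)) atTop (𝓝 t) := by
    have := (tendsto_nat_floor_mul_div_atTop ht.le).comp (tendsto_natCast_atTop_atTop (R := ℝ))
    simpa [Function.comp_def, div_eq_mul_inv] using this
  obtain ⟨R, hR⟩ := exists_forall_lt_abs_eq_zero hγs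
  obtain ⟨Cγ, hCγ⟩ := hγs.exists_bound_of_continuous hγ
  obtain ⟨C, hC⟩ := hHs.exists_bound_of_continuous hH
  have hlim : Tendsto (fun n : ℕ => ∫ y : ℝ, γ ((⌊(n : ℝ) * y⌋ : ℝ) / n)
      * ∫ x, H ((⌊(n : ℝ) * y⌋ : ℝ) / n + x) ∂(walkLaw U ⌊t * n⌋₊ (1 / n))) atTop
      (𝓝 (∫ y, γ y * ∫ x, H (y + x) ∂(velocityLaw t))) := by
    refine tendsto_integral_filter_of_dominated_convergence
      ((Set.Icc (-(R + 1)) (R + 1)).indicator fun _ => Cγ * C) (Eventually.of_forall fun n => ?_)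
      ?_ ((integrable_indicator_iff measurableSet_Icc).2 (integrableOn_const (by simp)))
      (ae_of_all _ fun y => ?_)
    · have hfloor : Measurable fun y : ℝ => ⌊(n : ℝ) * y⌋ :=
        Int.measurable_floor.comp (measurable_const_mul _)
      have hcount : Measurable fun k : ℤ => γ ((k : ℝ) / n)
          * ∫ x, H ((k : ℝ) / n + x) ∂(walkLaw U ⌊t * n⌋₊ (1 / n)) := measurable_of_countable _
      exact (hcount.comp hfloor).aestronglyMeasurable
    · filter_upwards [eventually_ge_atTop 1] with n hn
      refine ae_of_all _ fun y => ?_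
      have := hU.isProbabilityMeasure_walkLaw ⌊t * n⌋₊ (1 / n)
      by_cases hy : y ∈ Set.Icc (-(R + 1)) (R + 1)
      · rw [Set.indicator_of_mem hy, norm_mul]
        refine mul_le_mul (hCγ _) ?_ (norm_nonneg _) ((norm_nonneg _).trans (hCγ 0))
        refine (norm_integral_le_of_norm_le_const (ae_of_all _ fun x => hC _)).trans ?_
        rw [probReal_univ, mul_one]
      · rw [Set.indicator_of_notMem hy, hR, zero_mul, norm_zero]
        rw [Set.mem_Icc, ← abs_le, not_le] at hy
        have h1 := abs_floor_mul_div_sub_le y hn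
        have hn1 : 1 / (n : ℝ) ≤ 1 := div_le_one_of_le₀ (by exact_mod_cast hn) (Nat.cast_nonneg n)
        have h2 := abs_sub_abs_le_abs_sub y ((⌊(n : ℝ) * y⌋ : ℝ) / n)
        rw [abs_sub_comm] at h2
        linarith
    · exact ((hγ.tendsto y).comp (tendsto_floor_mul_div y)).mul
        (hU.tendsto_integral_walkLaw_translate hs hms (tendsto_floor_mul_div y) hH hHs)
  rw [integral_mul_integral_konno hγ hγs hH hHs ht]
  have hval : ∀ y, ∫ x, H (y + x) ∂(velocityLaw t)
      = 1 / Real.pi * ∫ θ in Set.Ioo 0 Real.pi, H (y + t * groupVelocity θ) := fun y => by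
    rw [integral_velocityLaw t (by fun_prop : Continuous _).stronglyMeasurable, smul_eq_mul]
  simp_rw [hval] at hlim
  refine hlim.congr' ?_
  filter_upwards [eventually_ge_atTop 1] with n hn
  exact (hU.tsum_mul_tsum_mul_walkProb _ hn hγs hHs).symm

end IsHadamardWalk

/-- **Hydrodynamic limit of quantum random walks.**
Fix a continuous nonnegative `γ : ℝ → ℝ` with compact support and `t > 0`. For `n ≥ 1`,
let `μ_n` be the law on `ℕ^ℤ` of the observed particle field `η_{⌊tn⌋}` of the system of
independent Hadamard quantum random walks with initial configuration `Θ_γ^n`;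
equivalently (product-Poisson identity), `μ_n = ⊗_j Poisson(B(j,⌊tn⌋))` with
`B(j,m) = Σ_k γ(k/n) p_m(k,j)` where
`p_m(k,j) = ½‖(U^m(δ_k⊗+))(j)‖² + ½‖(U^m(δ_k⊗−))(j)‖²` (the product measure is
characterized through its finite-dimensional marginals). Then for every continuous
`H : ℝ → ℝ` with compact support, the random variables `(1/n) Σ_k H(k/n) η_{⌊tn⌋}(k)`
converge in probability to `∫ H(x) ρ(t,x) dx`, where
`ρ(t,x) = (γ * f_t)(x) = ∫ γ(y)(1/t)f((x−y)/t) dy` and `f` is the Konno density. -/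
theorem hydrodynamic_limit_quantum_random_walks
    (U : QWState →ₗ[ℂ] QWState)
    (hU : ∀ (ψ : QWState) (k : ℤ),
      (U ψ) k 0 = (ψ (k - 1) 0 + ψ (k - 1) 1) / (Real.sqrt 2 : ℂ) ∧
      (U ψ) k 1 = (ψ (k + 1) 0 - ψ (k + 1) 1) / (Real.sqrt 2 : ℂ))
    (p : ℕ → ℤ → ℤ → ℝ)
    (hp : ∀ (m : ℕ) (k j : ℤ), p m k j =
      (1 / 2) * ‖((U ^ m) (deltaCoin k 0)) j‖ ^ 2
        + (1 / 2) * ‖((U ^ m) (deltaCoin k 1)) j‖ ^ 2)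
    (γ : ℝ → ℝ) (hγcont : Continuous γ) (hγnonneg : ∀ y, 0 ≤ γ y)
    (hγsupp : HasCompactSupport γ)
    (t : ℝ) (ht : 0 < t)
    (μ : ℕ → Measure (ℤ → ℕ)) (hμprob : ∀ n, IsProbabilityMeasure (μ n))
    (hμ : ∀ (n : ℕ), 1 ≤ n → ∀ (F : Finset ℤ),
      (μ n).map (fun η (j : ↥F) => η j.1)
        = Measure.pi (fun j : ↥F => poissonMeasure (Real.toNNReal
            (∑' k : ℤ, γ ((k : ℝ) / (n : ℝ)) * p ⌊t * (n : ℝ)⌋₊ k j.1))))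
    (H : ℝ → ℝ) (hHcont : Continuous H) (hHsupp : HasCompactSupport H) :
    ∀ ε : ℝ, 0 < ε →
      Tendsto
        (fun n : ℕ => μ n {η : ℤ → ℕ |
          ε < |(1 / (n : ℝ)) * (∑' k : ℤ, H ((k : ℝ) / (n : ℝ)) * (η k : ℝ))
            - ∫ x : ℝ, H x * ∫ y : ℝ, γ y * ((1 / t) * konno ((x - y) / t))|})
        atTop (𝓝 (0 : ℝ≥0∞)) := by
  have hW : IsHadamardWalk U := hU
  have hpU : p = walkProb U := by
    funext m k j
    exact hp m k j
  subst hpU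
  intro ε hε
  set L := ∫ x : ℝ, H x * ∫ y : ℝ, γ y * ((1 / t) * konno ((x - y) / t)) with hL
  set B : ℕ → ℤ → ℝ := fun n j =>
    ∑' k : ℤ, γ ((k : ℝ) / (n : ℝ)) * walkProb U ⌊t * (n : ℝ)⌋₊ k j with hB
  have hB0 : ∀ n j, 0 ≤ B n j := fun n j =>
    tsum_nonneg fun k => mul_nonneg (hγnonneg _) (walkProb_nonneg U _ _ _)
  have hmean : Tendsto (fun n : ℕ => (1 / (n : ℝ)) * ∑' j : ℤ, H ((j : ℝ) / n) * B n j) atTop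
      (𝓝 L) := hW.tendsto_mean hγcont hγsupp hHcont hHsupp ht
  have hH2s : HasCompactSupport fun x => H x ^ 2 := hHsupp.comp_left (g := fun x => x ^ 2) (by simp)
  have hvar : Tendsto (fun n : ℕ => ENNReal.ofReal (1 / (n : ℝ) *
      ((1 / (n : ℝ)) * ∑' j : ℤ, H ((j : ℝ) / n) ^ 2 * B n j) / (ε / 2) ^ 2)) atTop (𝓝 0) := by
    have h := ((tendsto_one_div_atTop_nhds_zero_nat (𝕜 := ℝ)).mul
      (hW.tendsto_mean hγcont hγsupp (hHcont.pow 2) hH2s ht)).div_const ((ε / 2) ^ 2)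
    rw [zero_mul, zero_div] at h
    simpa using ENNReal.tendsto_ofReal h
  refine tendsto_of_tendsto_of_tendsto_of_le_of_le' tendsto_const_nhds hvar
    (Eventually.of_forall fun n => zero_le) ?_
  filter_upwards [eventually_ge_atTop 1, Metric.tendsto_nhds.1 hmean (ε / 2) (half_pos hε)]
    with n hn hclose
  set F := (finite_support_comp_div hHsupp hn).toFinset with hF
  have hHF : ∀ k ∉ F, H ((k : ℝ) / n) = 0 := fun k hk => by simpa [hF] using hk
  have hsum : ∀ b : ℤ → ℝ, (1 / (n : ℝ)) * ∑' j : ℤ, H ((j : ℝ) / n) * b j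
      = ∑ j : ↥F, H ((j.1 : ℝ) / n) / n * b j.1 := by
    intro b
    rw [tsum_eq_sum (s := F) fun j hj => by rw [hHF j hj, zero_mul], ← Finset.sum_coe_sort,
      Finset.mul_sum]
    exact Finset.sum_congr rfl fun j _ => by ring
  have hsum2 : 1 / (n : ℝ) * ((1 / (n : ℝ)) * ∑' j : ℤ, H ((j : ℝ) / n) ^ 2 * B n j)
      = ∑ j : ↥F, (H ((j.1 : ℝ) / n) / n) ^ 2 * B n j.1 := by
    rw [tsum_eq_sum (s := F) fun j hj => by rw [hHF j hj, zero_pow two_ne_zero, zero_mul],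
      ← Finset.sum_coe_sort, Finset.mul_sum, Finset.mul_sum]
    exact Finset.sum_congr rfl fun j _ => by ring
  have hcheb := measure_pi_poisson_le (fun j : ↥F => Real.toNNReal (B n j.1))
    (fun j : ↥F => H ((j.1 : ℝ) / n) / n) (half_pos hε)
  simp only [Real.coe_toNNReal _ (hB0 n _)] at hcheb
  rw [← hsum2, ← hμ n hn F, ← hsum (B n)] at hcheb
  have hmeas : Measurable fun (η : ℤ → ℕ) (j : ↥F) => η j.1 := by fun_prop
  refine (measure_mono fun η hη => ?_).trans
    ((Measure.le_map_apply hmeas.aemeasurable _).trans hcheb)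
  rw [Set.mem_ofPred_eq, hsum fun j => (η j : ℝ)] at hη
  rw [Set.mem_preimage, Set.mem_ofPred_eq]
  rw [Real.dist_eq] at hclose
  have htri := abs_sub_le (∑ j : ↥F, H ((j.1 : ℝ) / n) / n * (η j.1 : ℝ))
    ((1 / (n : ℝ)) * ∑' j : ℤ, H ((j : ℝ) / n) * B n j) L
  linarith

end
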